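/- Let A and B be n×n real symmetric positive semidefinite matrices with trace 1, let α > 0 with α ≠ 1, and let k be an integer with 1 ≤ k ≤ n−1. Then the low-rank Rényi entropy of the Kronecker product of the low-rank completions is additive: S_α^{2nk−k²}(L_k(A) ⊗ L_k(B)) = S_α^k(A) + S_α^k(B), where L_k(A) ⊗ L_k(B) is an n²×n² matrix and 2nk−k² = n² − (n−k)². -/

import Mathlib

open scoped BigOperators

/-- The eigenvalues of a real symmetric matrix, sorted in nonincreasing order
    (returns `0` if the matrix is not symmetric). -/
noncomputable def eigs {n : ℕ} (A : Matrix (Fin n) (Fin n) ℝ) : Fin n → ℝ :=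
  if h : A.IsHermitian then
    fun i => (h.eigenvalues ∘ Tuple.sort h.eigenvalues) i.rev
  else 0

/-- The sum of `f i` over the indices `i < k` (the `k` largest eigenvalues when
    `f` is nonincreasing). -/
noncomputable def topSum {n : ℕ} (k : ℕ) (f : Fin n → ℝ) : ℝ :=
  ∑ i ∈ Finset.univ.filter fun i : Fin n => (i : ℕ) < k, f i

/-- `λ_r(A) = (1 - ∑_{i=1}^k λ_i(A)) / (n - k)`. -/
noncomputable def lamR {n : ℕ} (k : ℕ) (A : Matrix (Fin n) (Fin n) ℝ) : ℝ :=
  (1 - topSum k (eigs A)) / ((n : ℝ) - (k : ℝ))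

/-- Low-rank matrix-based Rényi entropy
    `S_α^k(A) = (1/(1-α)) log₂(∑_{i=1}^k λ_i(A)^α + (n-k) λ_r(A)^α)`. -/
noncomputable def Slow {n : ℕ} (α : ℝ) (k : ℕ) (A : Matrix (Fin n) (Fin n) ℝ) : ℝ :=
  (1 / (1 - α)) * Real.logb 2
    (topSum k (fun i => eigs A i ^ α) + ((n : ℝ) - (k : ℝ)) * lamR k A ^ α)

/-- Matrix-based Rényi entropy `S_α(A) = (1/(1-α)) log₂(∑_{i=1}^n λ_i(A)^α)`. -/
noncomputable def Sfull {n : ℕ} (α : ℝ) (A : Matrix (Fin n) (Fin n) ℝ) : ℝ :=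
  (1 / (1 - α)) * Real.logb 2 (∑ i, eigs A i ^ α)

theorem exists_perm_eigs {n : ℕ} {A : Matrix (Fin n) (Fin n) ℝ} (hA : A.IsHermitian) :
    ∃ σ : Equiv.Perm (Fin n), eigs A = hA.eigenvalues ∘ σ :=
  ⟨Fin.revPerm.trans (Tuple.sort hA.eigenvalues), by ext i; rw [eigs, dif_pos hA]; simp⟩

theorem eigs_antitone {n : ℕ} (A : Matrix (Fin n) (Fin n) ℝ) : Antitone (eigs A) := by
  intro i j hij
  unfold eigs
  split_ifs with h
  · exact Tuple.monotone_sort h.eigenvalues (Fin.rev_le_rev.mpr hij)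
  · exact le_rfl

theorem eigs_nonneg {n : ℕ} {A : Matrix (Fin n) (Fin n) ℝ} (hA : A.PosSemidef) (i : Fin n) :
    0 ≤ eigs A i := by
  obtain ⟨σ, hσ⟩ := exists_perm_eigs hA.isHermitian
  rw [hσ]
  exact hA.eigenvalues_nonneg _

theorem sum_eigs_eq_trace {n : ℕ} {A : Matrix (Fin n) (Fin n) ℝ} (hA : A.IsHermitian) :
    ∑ i, eigs A i = A.trace := by
  obtain ⟨σ, hσ⟩ := exists_perm_eigs hA
  simp only [hσ, Function.comp_apply, Equiv.sum_comp σ hA.eigenvalues]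
  simp [hA.trace_eq_sum_eigenvalues]

theorem roots_charpoly_eq_map_eigs {n : ℕ} {A : Matrix (Fin n) (Fin n) ℝ} (hA : A.IsHermitian) :
    A.charpoly.roots = Finset.univ.val.map (eigs A) := by
  obtain ⟨σ, hσ⟩ := exists_perm_eigs hA
  rw [hA.roots_charpoly_eq_eigenvalues, hσ, ← Multiset.map_map _ (⇑σ),
    Multiset.map_univ_val_equiv]
  rfl

open Polynomial Kronecker in
theorem charpoly_kronecker_eq_prod_eigenvalues {l m : Type*} [Fintype l] [Fintype m]
    [DecidableEq l] [DecidableEq m] {A : Matrix l l ℝ} {B : Matrix m m ℝ}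
    (hA : A.IsHermitian) (hB : B.IsHermitian) :
    (A ⊗ₖ B).charpoly =
      ∏ p : l × m, (X - C (hA.eigenvalues p.1 * hB.eigenvalues p.2)) := by
  conv_lhs =>
    rw [hA.spectral_theorem, hB.spectral_theorem, Unitary.conjStarAlgAut_apply,
      Unitary.conjStarAlgAut_apply, Matrix.mul_kronecker_mul, Matrix.charpoly_mul_comm,
      Matrix.mul_kronecker_mul, ← mul_assoc, ← Matrix.mul_kronecker_mul]
  simp [Matrix.charpoly_diagonal, Matrix.diagonal_kronecker_diagonal]

open Kronecker in
theorem map_eigs_reindex_kronecker {n : ℕ} {A B : Matrix (Fin n) (Fin n) ℝ}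
    (hA : A.IsHermitian) (hB : B.IsHermitian) :
    Finset.univ.val.map (eigs (Matrix.reindex finProdFinEquiv finProdFinEquiv (A ⊗ₖ B))) =
      Finset.univ.val.map fun p : Fin n × Fin n => eigs A p.1 * eigs B p.2 := by
  have hM : (Matrix.reindex finProdFinEquiv finProdFinEquiv (A ⊗ₖ B)).IsHermitian := by
    have h : (A ⊗ₖ B).IsHermitian := by
      rw [Matrix.IsHermitian, Matrix.conjTranspose_kronecker, hA.eq, hB.eq]
    exact h.submatrix _
  obtain ⟨σ, hσ⟩ := exists_perm_eigs hA
  obtain ⟨τ, hτ⟩ := exists_perm_eigs hB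
  rw [← roots_charpoly_eq_map_eigs hM, Matrix.charpoly_reindex,
    charpoly_kronecker_eq_prod_eigenvalues hA hB, Polynomial.roots_prod _ _
      (Finset.prod_ne_zero_iff.mpr fun p _ => Polynomial.X_sub_C_ne_zero _)]
  have h : (fun p : Fin n × Fin n => eigs A p.1 * eigs B p.2) =
      (fun p => hA.eigenvalues p.1 * hB.eigenvalues p.2) ∘ (σ.prodCongr τ) := by
    ext p
    simp [hσ, hτ]
  rw [h, ← Multiset.map_map _ (⇑(σ.prodCongr τ)), Multiset.map_univ_val_equiv]
  simp only [Polynomial.roots_X_sub_C, Multiset.bind_singleton]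

theorem topSum_add_of_eq_const {n k : ℕ} (hk : k ≤ n) {f : Fin n → ℝ} {c : ℝ}
    (hf : ∀ i : Fin n, k ≤ (i : ℕ) → f i = c) :
    topSum k f + ((n : ℝ) - k) * c = ∑ i, f i := by
  have hcard : (Finset.univ.filter fun i : Fin n => ¬ (i : ℕ) < k).card = n - k := by
    have h := Finset.card_filter_add_card_filter_not (s := (Finset.univ : Finset (Fin n)))
      (fun i : Fin n => (i : ℕ) < k)
    rw [Fin.card_filter_val_lt, Finset.card_univ, Fintype.card_fin, min_eq_right hk] at h
    omega
  rw [topSum, ← Finset.sum_filter_add_sum_filter_not Finset.univ (fun i : Fin n => (i : ℕ) < k),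
    Finset.sum_congr rfl (s₁ := Finset.univ.filter fun i : Fin n => ¬ (i : ℕ) < k)
      (g := fun _ => c) (fun i hi => hf i (by simpa using hi)),
    Finset.sum_const, hcard, nsmul_eq_mul, Nat.cast_sub hk]

theorem Slow_eq_Sfull_of_eq_const {n k : ℕ} (hk : k < n) (α : ℝ) {M : Matrix (Fin n) (Fin n) ℝ}
    {c : ℝ} (hsum : ∑ i, eigs M i = 1) (hc : ∀ i : Fin n, k ≤ (i : ℕ) → eigs M i = c) :
    Slow α k M = Sfull α M := by
  have hnk : ((n : ℝ) - k) ≠ 0 := sub_ne_zero.mpr (by exact_mod_cast hk.ne')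
  have hlam : lamR k M = c := by
    rw [lamR, div_eq_iff hnk, ← hsum, ← topSum_add_of_eq_const hk.le hc]
    ring
  rw [Slow, Sfull, hlam, topSum_add_of_eq_const hk.le fun i hi => by rw [hc i hi]]

theorem topSum_congr {n k : ℕ} {f g : Fin n → ℝ} (h : ∀ i : Fin n, (i : ℕ) < k → f i = g i) :
    topSum k f = topSum k g :=
  Finset.sum_congr rfl fun i hi => h i (by simpa using hi)

theorem Slow_congr {n k : ℕ} (α : ℝ) {L A : Matrix (Fin n) (Fin n) ℝ}
    (h : ∀ i : Fin n, (i : ℕ) < k → eigs L i = eigs A i) : Slow α k L = Slow α k A := by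
  rw [Slow, Slow, lamR, lamR, topSum_congr h, topSum_congr fun i hi => by rw [h i hi]]

theorem Antitone.eq_const_of_le_card {N K : ℕ} {g : Fin N → ℝ} (hg : Antitone g) {c : ℝ}
    (hc : ∀ i, c ≤ g i) (hcard : N - K ≤ (Finset.univ.filter fun i => g i = c).card)
    (i : Fin N) (hi : K ≤ (i : ℕ)) : g i = c := by
  by_contra hne
  have hsub : (Finset.univ.filter fun j => g j = c) ⊆ Finset.Ioi i := by
    intro j hj
    simp only [Finset.mem_filter, Finset.mem_univ, true_and] at hj
    rw [Finset.mem_Ioi]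
    by_contra! hji
    exact hne (le_antisymm ((hg hji).trans hj.le) (hc i))
  have h := hcard.trans (Finset.card_le_card hsub)
  rw [Fin.card_Ioi] at h
  omega

theorem lamR_nonneg {n k : ℕ} (hk : k ≤ n) {A : Matrix (Fin n) (Fin n) ℝ} (hA : A.PosSemidef)
    (htr : A.trace = 1) : 0 ≤ lamR k A := by
  refine div_nonneg (sub_nonneg.mpr ?_) (sub_nonneg.mpr (by exact_mod_cast hk))
  rw [← htr, ← sum_eigs_eq_trace hA.isHermitian]
  exact Finset.sum_le_sum_of_subset_of_nonneg (Finset.filter_subset _ _)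
    fun i _ _ => eigs_nonneg hA i

theorem lamR_le_eigs {n k : ℕ} (hk : k < n) {L A : Matrix (Fin n) (Fin n) ℝ}
    (hL : ∀ i : Fin n, eigs L i = if (i : ℕ) < k then eigs A i else lamR k A) (i : Fin n) :
    lamR k A ≤ eigs L i := by
  by_cases hi : (i : ℕ) < k
  · have h := eigs_antitone L (show i ≤ ⟨k, hk⟩ from hi.le)
    rwa [hL ⟨k, hk⟩, if_neg (lt_irrefl k)] at h
  · rw [hL, if_neg hi]

theorem sum_eigs_lowRank {n k : ℕ} (hk : k < n) {L A : Matrix (Fin n) (Fin n) ℝ}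
    (hL : ∀ i : Fin n, eigs L i = if (i : ℕ) < k then eigs A i else lamR k A) :
    ∑ i, eigs L i = 1 := by
  have hnk : ((n : ℝ) - k) ≠ 0 := sub_ne_zero.mpr (by exact_mod_cast hk.ne')
  rw [← topSum_add_of_eq_const hk.le (f := eigs L) (c := lamR k A)
      fun i hi => by rw [hL, if_neg hi.not_gt],
    topSum_congr fun i hi => by rw [hL, if_pos hi], lamR, mul_div_cancel₀ _ hnk]
  ring

theorem sum_rpow_pos_of_sum_eq_one {ι : Type*} [Fintype ι] (α : ℝ) {f : ι → ℝ}
    (hf : ∀ i, 0 ≤ f i) (hsum : ∑ i, f i = 1) : 0 < ∑ i, f i ^ α := by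
  obtain ⟨i, -, hi⟩ := Finset.exists_ne_zero_of_sum_ne_zero (hsum.trans_ne one_ne_zero)
  exact Finset.sum_pos' (fun j _ => Real.rpow_nonneg (hf j) α)
    ⟨i, Finset.mem_univ i, Real.rpow_pos_of_pos ((hf i).lt_of_ne' hi) α⟩

open Matrix in
/-- additivity of the low-rank Rényi entropy under Kronecker products of
low-rank completions.  `LA` (resp. `LB`) plays the role of `L_k(A)` (resp. `L_k(B)`):
a symmetric matrix whose `k` largest eigenvalues agree with those of `A` and whose
remaining `n - k` eigenvalues all equal `λ_r(A)`. The Kronecker product is reindexed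
along `finProdFinEquiv : Fin n × Fin n ≃ Fin (n * n)`, which does not change its
eigenvalues. -/
theorem lowRank_entropy_kronecker_additive {n : ℕ} (A B LA LB : Matrix (Fin n) (Fin n) ℝ)
    (α : ℝ) (k : ℕ)
    (hA : A.PosSemidef) (hB : B.PosSemidef) (htrA : A.trace = 1) (htrB : B.trace = 1)
    (hα : 0 < α) (hα1 : α ≠ 1) (hk1 : 1 ≤ k) (hkn : k ≤ n - 1)
    (hLA : LA.IsHermitian) (hLB : LB.IsHermitian)
    (hLAspec : ∀ i : Fin n, eigs LA i = if (i : ℕ) < k then eigs A i else lamR k A)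
    (hLBspec : ∀ i : Fin n, eigs LB i = if (i : ℕ) < k then eigs B i else lamR k B) :
    Slow α (2 * n * k - k ^ 2)
        ((Matrix.reindex finProdFinEquiv finProdFinEquiv)
          (Matrix.kroneckerMap (· * ·) LA LB)) =
      Slow α k A + Slow α k B := by
  have hk : k < n := by omega
  have hKN : 2 * n * k - k ^ 2 = n * n - (n - k) * (n - k) := by
    obtain ⟨m, rfl⟩ := Nat.exists_eq_add_of_lt hk
    have h₁ : k + m + 1 - k = m + 1 := by omega
    rw [h₁]
    refine Eq.trans (b := k ^ 2 + 2 * k * (m + 1)) (Nat.sub_eq_of_eq_add ?_)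
      (Nat.sub_eq_of_eq_add ?_).symm <;> ring
  have hlt : 2 * n * k - k ^ 2 < n * n := by
    have h₁ : 0 < (n - k) * (n - k) := Nat.mul_pos (by omega) (by omega)
    have h₂ : 0 < n * n := Nat.mul_pos (by omega) (by omega)
    omega
  have hconstA : ∀ i : Fin n, k ≤ (i : ℕ) → eigs LA i = lamR k A :=
    fun i hi => by rw [hLAspec, if_neg hi.not_gt]
  have hconstB : ∀ i : Fin n, k ≤ (i : ℕ) → eigs LB i = lamR k B :=
    fun i hi => by rw [hLBspec, if_neg hi.not_gt]
  have hrA := lamR_nonneg hk.le hA htrA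
  have hrB := lamR_nonneg hk.le hB htrB
  have hleA := lamR_le_eigs hk hLAspec
  have hleB := lamR_le_eigs hk hLBspec
  have hsumA := sum_eigs_lowRank hk hLAspec
  have hsumB := sum_eigs_lowRank hk hLBspec
  have hmap := map_eigs_reindex_kronecker hLA hLB
  set M := Matrix.reindex finProdFinEquiv finProdFinEquiv
    (Matrix.kroneckerMap (· * ·) LA LB)
  have hsum (f : ℝ → ℝ) : ∑ i, f (eigs M i) = ∑ i, ∑ j, f (eigs LA i * eigs LB j) := by
    have h := congrArg (fun s => (s.map f).sum) hmap
    simp only [Multiset.map_map] at h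
    rw [← Fintype.sum_prod_type']
    exact h
  have hmin (i) : lamR k A * lamR k B ≤ eigs M i := by
    have hi : eigs M i ∈ Finset.univ.val.map (eigs M) :=
      Multiset.mem_map_of_mem _ (Finset.mem_univ i)
    rw [hmap] at hi
    obtain ⟨p, -, hp⟩ := Multiset.mem_map.mp hi
    rw [← hp]
    exact mul_le_mul (hleA _) (hleB _) hrB (hrA.trans (hleA _))
  have hcard : (n - k) * (n - k) ≤
      (Finset.univ.filter fun i => eigs M i = lamR k A * lamR k B).card := by
    have h := congrArg (Multiset.countP (· = lamR k A * lamR k B)) hmap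
    rw [Multiset.countP_map, Multiset.countP_map] at h
    refine le_trans ?_ h.ge
    have hsub : Finset.Ici (⟨k, hk⟩ : Fin n) ×ˢ Finset.Ici (⟨k, hk⟩ : Fin n) ⊆
        Finset.univ.filter fun p : Fin n × Fin n =>
          eigs LA p.1 * eigs LB p.2 = lamR k A * lamR k B := by
      intro p hp
      rw [Finset.mem_product, Finset.mem_Ici, Finset.mem_Ici] at hp
      simp [hconstA p.1 hp.1, hconstB p.2 hp.2]
    have h' := Finset.card_le_card hsub
    rw [Finset.card_product, Fin.card_Ici] at h'
    exact h'
  have hconst := (eigs_antitone M).eq_const_of_le_card (K := 2 * n * k - k ^ 2) hmin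
    (by omega)
  have hsumM : ∑ i, eigs M i = 1 := by
    rw [hsum fun x => x, ← Finset.sum_mul_sum, hsumA, hsumB, one_mul]
  rw [Slow_eq_Sfull_of_eq_const hlt α hsumM hconst,
    ← Slow_congr (L := LA) (A := A) α fun i hi => by rw [hLAspec, if_pos hi],
    ← Slow_congr (L := LB) (A := B) α fun i hi => by rw [hLBspec, if_pos hi],
    Slow_eq_Sfull_of_eq_const hk α hsumA hconstA, Slow_eq_Sfull_of_eq_const hk α hsumB hconstB,
    Sfull, Sfull, Sfull, ← mul_add, hsum (· ^ α)]
  have hA0 (i) : 0 ≤ eigs LA i := hrA.trans (hleA i)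
  have hB0 (i) : 0 ≤ eigs LB i := hrB.trans (hleB i)
  rw [← Real.logb_mul (sum_rpow_pos_of_sum_eq_one α hA0 hsumA).ne'
    (sum_rpow_pos_of_sum_eq_one α hB0 hsumB).ne', Finset.sum_mul_sum]
  simp only [Real.mul_rpow (hA0 _) (hB0 _)]
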